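/- Let k ≥ 1, let S be a symmetric positive definite (k+1) × (k+1) real matrix, and let b ∈ ℝ^{k+1}. Let S_G denote the leading principal k × k submatrix of S and b_G ∈ ℝ^k the vector of the first k coordinates of b (so S_G is symmetric positive definite). Then bᵀ S⁻¹ b ≥ b_Gᵀ S_G⁻¹ b_G. In particular, adding one extra moment condition does not increase the asymptotic variance (bᵀ S⁻¹ b)⁻¹ of the GMM estimator of the scalar parameter α. -/

import Mathlib

open Matrix

namespace Matrix

variable {m n : Type*} [Fintype m] [Fintype n] [DecidableEq m] [DecidableEq n]

lemma PosDef.two_mul_dotProduct_sub_le {S : Matrix n n ℝ} (hS : S.PosDef) (b x : n → ℝ) :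
    2 * (x ⬝ᵥ b) - x ⬝ᵥ S *ᵥ x ≤ b ⬝ᵥ S⁻¹ *ᵥ b := by
  have hdet : IsUnit S.det := (isUnit_iff_isUnit_det S).mp hS.isUnit
  have hT : Sᵀ = S := by simpa using hS.isHermitian.eq
  have hinv : S *ᵥ S⁻¹ *ᵥ b = b := by rw [mulVec_mulVec, mul_nonsing_inv S hdet, one_mulVec]
  have hcross : (S⁻¹ *ᵥ b) ⬝ᵥ S *ᵥ x = x ⬝ᵥ b := by
    rw [dotProduct_mulVec, ← mulVec_transpose, hT, hinv, dotProduct_comm]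
  have hnonneg := hS.posSemidef.dotProduct_mulVec_nonneg (S⁻¹ *ᵥ b - x)
  simp only [star_trivial, mulVec_sub, dotProduct_sub, sub_dotProduct, hinv, hcross] at hnonneg
  rw [dotProduct_comm (S⁻¹ *ᵥ b) b] at hnonneg
  linarith

theorem PosDef.dotProduct_inv_submatrix_mulVec_le {S : Matrix n n ℝ} (hS : S.PosDef)
    {e : m → n} (he : Function.Injective e) (b : n → ℝ) :
    (b ∘ e) ⬝ᵥ (S.submatrix e e)⁻¹ *ᵥ (b ∘ e) ≤ b ⬝ᵥ S⁻¹ *ᵥ b := by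
  have hdet : IsUnit (S.submatrix e e).det :=
    (isUnit_iff_isUnit_det _).mp (hS.submatrix he).isUnit
  set w := (S.submatrix e e)⁻¹ *ᵥ (b ∘ e) with hw
  have hinv : S.submatrix e e *ᵥ w = b ∘ e := by
    rw [hw, mulVec_mulVec, mul_nonsing_inv _ hdet, one_mulVec]
  let P : Matrix n m ℝ := (1 : Matrix n n ℝ).submatrix id e
  have hPdot (v : n → ℝ) : (P *ᵥ w) ⬝ᵥ v = w ⬝ᵥ (v ∘ e) := by
    rw [dotProduct_comm, dotProduct_mulVec, dotProduct_comm]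
    congr 1
    ext i
    simp [P, vecMul, dotProduct, one_apply]
  have hSP : (S *ᵥ P *ᵥ w) ∘ e = S.submatrix e e *ᵥ w := by
    have hmul : S * P = S.submatrix id e := by
      ext i j
      simp [P, mul_apply, one_apply]
    rw [mulVec_mulVec, hmul]
    rfl
  have hle := hS.two_mul_dotProduct_sub_le b (P *ᵥ w)
  rw [hPdot, hPdot, hSP, hinv, dotProduct_comm w] at hle
  linarith

end Matrix

/-- adding one extra moment condition does not decrease `bᵀ S⁻¹ b`, i.e. does not
increase the asymptotic variance `(bᵀ S⁻¹ b)⁻¹` of the GMM estimator: for a symmetric positive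
definite `(k+1) × (k+1)` matrix `S` with leading principal `k × k` submatrix `S_G` and
`b_G` the first `k` coordinates of `b`, one has `bᵀ S⁻¹ b ≥ b_Gᵀ S_G⁻¹ b_G`. -/
theorem gmm_add_moment_no_efficiency_loss {k : ℕ} (hk : 1 ≤ k)
    (S : Matrix (Fin (k + 1)) (Fin (k + 1)) ℝ) (hS : S.PosDef) (b : Fin (k + 1) → ℝ) :
    (b ∘ Fin.castSucc) ⬝ᵥ (S.submatrix Fin.castSucc Fin.castSucc)⁻¹ *ᵥ (b ∘ Fin.castSucc) ≤
      b ⬝ᵥ S⁻¹ *ᵥ b := by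
  exact hS.dotProduct_inv_submatrix_mulVec_le (Fin.castSucc_injective k) b
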